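/- Let n ≥ 2, let U ⊂ ℝⁿ⁺¹ be a bounded open set whose closure does not contain 0, let ζ ∈ C_c^∞(ℝⁿ⁺¹∖{0}; ℝ), let W : ℝⁿ⁺¹ → ℝⁿ⁺¹ be C², let q : ℝⁿ⁺¹ → ℂ be bounded and measurable, and let ε > 0. Then there exists C > 0 such that for every h ∈ (0,1] and every w ∈ C_c^∞(U; ℂ): ‖L_{φ,W,q,ε}(ζ·w) − ζ·(L_{φ,W,q,ε} w)‖_{H⁻¹_h(U)} ≤ C·h·‖w‖_{L²(U)}. -/

import Mathlib

open MeasureTheory Complex Set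

noncomputable section

/-- Euclidean space `ℝ^d`. -/
abbrev Euc (d : ℕ) := EuclideanSpace ℝ (Fin d)

/-- Partial derivative in the `j`-th coordinate direction. -/
def pd {d : ℕ} {F : Type*} [NormedAddCommGroup F] [NormedSpace ℝ F]
    (j : Fin d) (u : Euc d → F) : Euc d → F :=
  fun x => fderiv ℝ u x (EuclideanSpace.single j 1)

/-- The magnetic Schrödinger operator
`L_{W,q} u = -Δu - 2i⟨W,∇u⟩ - i (div W) u + (‖W‖² + q) u`. -/
def magSchrodinger {d : ℕ} (W : Euc d → Euc d) (q : Euc d → ℂ) (u : Euc d → ℂ) :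
    Euc d → ℂ :=
  fun x =>
    -(∑ j, pd j (pd j u) x)
    - 2 * Complex.I * ∑ j, ((W x j : ℝ) : ℂ) * pd j u x
    - Complex.I * (((∑ j, pd j (fun y => W y j) x) : ℝ) : ℂ) * u x
    + ((((‖W x‖ ^ 2 : ℝ)) : ℂ) + q x) * u x

/-- The logarithmic limiting Carleman weight `φ(x) = log ‖x‖`. -/
def carlWeight {d : ℕ} (x : Euc d) : ℝ := Real.log ‖x‖

/-- The conjugated operator `L_{φ,W,q} w = h² e^{φ/h} L_{W,q}(e^{-φ/h} w)`. -/
def conjOp {d : ℕ} (h : ℝ) (W : Euc d → Euc d) (q : Euc d → ℂ) (w : Euc d → ℂ) :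
    Euc d → ℂ :=
  fun x =>
    ((h : ℂ) ^ 2) * Complex.exp (((carlWeight x / h : ℝ) : ℂ)) *
      magSchrodinger W q
        (fun y => Complex.exp (((-(carlWeight y / h) : ℝ) : ℂ)) * w y) x

/-- The conjugated operator `L_{φ,W,q,ε} w = h² e^{φ/h + φ²/(2ε)} L_{W,q}(e^{-φ/h - φ²/(2ε)} w)`. -/
def conjOpEps {d : ℕ} (h ε : ℝ) (W : Euc d → Euc d) (q : Euc d → ℂ) (w : Euc d → ℂ) :
    Euc d → ℂ :=
  fun x =>
    ((h : ℂ) ^ 2) *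
      Complex.exp (((carlWeight x / h + (carlWeight x) ^ 2 / (2 * ε) : ℝ) : ℂ)) *
      magSchrodinger W q
        (fun y =>
          Complex.exp (((-(carlWeight y / h + (carlWeight y) ^ 2 / (2 * ε)) : ℝ) : ℂ)) * w y) x

/-- `w ∈ C_c^∞(U; ℂ)`. -/
def IsTest {d : ℕ} (U : Set (Euc d)) (w : Euc d → ℂ) : Prop :=
  ContDiff ℝ (⊤ : ℕ∞) w ∧ HasCompactSupport w ∧ tsupport w ⊆ U

/-- The `L²` norm on a set. -/
def L2normOn {d : ℕ} (U : Set (Euc d)) (w : Euc d → ℂ) : ℝ :=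
  Real.sqrt (∫ x in U, ‖w x‖ ^ 2)

/-- The semiclassical `H¹` norm on an open set. -/
def H1norm {d : ℕ} (h : ℝ) (U : Set (Euc d)) (ψ : Euc d → ℂ) : ℝ :=
  Real.sqrt ((∫ x in U, ‖ψ x‖ ^ 2) + h ^ 2 * ∫ x in U, ∑ j, ‖pd j ψ x‖ ^ 2)

/-- The semiclassical `H⁻¹` norm on an open set, defined by duality against
smooth compactly supported test functions. -/
def Hneg1norm {d : ℕ} (h : ℝ) (U : Set (Euc d)) (v : Euc d → ℂ) : ℝ :=
  sSup {r : ℝ | ∃ ψ : Euc d → ℂ, IsTest U ψ ∧ H1norm h U ψ ≤ 1 ∧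
    r = ‖∫ x in U, v x * (starRingEnd ℂ) (ψ x)‖}

/-- `ζ ∈ C_c^∞(U; ℝ)`. -/
def IsTestR {d : ℕ} (U : Set (Euc d)) (w : Euc d → ℝ) : Prop :=
  ContDiff ℝ (⊤ : ℕ∞) w ∧ HasCompactSupport w ∧ tsupport w ⊆ U

open ComplexConjugate

section Derivatives

variable {d : ℕ}

lemma pd_mul {j : Fin d} {u v : Euc d → ℂ} {x : Euc d}
    (hu : DifferentiableAt ℝ u x) (hv : DifferentiableAt ℝ v x) :
    pd j (fun y => u y * v y) x = pd j u x * v x + u x * pd j v x := by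
  have := (hu.hasFDerivAt.mul' hv.hasFDerivAt).fderiv
  simp only [pd]
  rw [show (fun y => u y * v y) = u * v from rfl, this]
  simp
  ring

lemma contDiff_pd (j : Fin d) {u : Euc d → ℂ} (hu : ContDiff ℝ (⊤ : ℕ∞) u) :
    ContDiff ℝ (⊤ : ℕ∞) (pd j u) :=
  (hu.fderiv_right (m := (⊤ : ℕ∞)) (by simp)).clm_apply contDiff_const

lemma contDiffAt_pd (j : Fin d) {u : Euc d → ℂ} {x : Euc d}
    (hu : ContDiffAt ℝ (⊤ : ℕ∞) u x) : ContDiffAt ℝ (⊤ : ℕ∞) (pd j u) x :=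
  (hu.fderiv_right (m := (⊤ : ℕ∞)) (by simp)).clm_apply contDiffAt_const

lemma hasCompactSupport_pd (j : Fin d) {u : Euc d → ℂ} (hu : HasCompactSupport u) :
    HasCompactSupport (pd j u) :=
  hu.fderiv_apply ℝ _

lemma pd_conj (j : Fin d) (u : Euc d → ℂ) (x : Euc d) :
    pd j (fun y => conj (u y)) x = conj (pd j u x) := by
  have := Complex.conjCLE.comp_fderiv (f := u) (x := x)
  simp only [pd]
  rw [show (fun y => conj (u y)) = Complex.conjCLE ∘ u from rfl, this]
  simp

lemma pd_pd_mul (j : Fin d) {u v : Euc d → ℂ} {x : Euc d}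
    (hu : ContDiffAt ℝ (⊤ : ℕ∞) u x) (hv : ContDiffAt ℝ (⊤ : ℕ∞) v x) :
    pd j (pd j (fun y => u y * v y)) x =
      pd j (pd j u) x * v x + 2 * (pd j u x * pd j v x) + u x * pd j (pd j v) x := by
  have du : ∀ {f : Euc d → ℂ} {y : Euc d}, ContDiffAt ℝ (⊤ : ℕ∞) f y → DifferentiableAt ℝ f y :=
    fun hf => hf.differentiableAt (by simp)
  have hev : pd j (fun y => u y * v y) =ᶠ[nhds x]
      fun y => pd j u y * v y + u y * pd j v y := by
    have h1 := hu.of_le (m := 1) (by exact_mod_cast le_top) |>.eventually (by simp)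
    have h2 := hv.of_le (m := 1) (by exact_mod_cast le_top) |>.eventually (by simp)
    filter_upwards [h1, h2] with y hy1 hy2
    exact pd_mul (hy1.differentiableAt (by simp)) (hy2.differentiableAt (by simp))
  have e1 : pd j (pd j (fun y => u y * v y)) x =
      pd j (fun y => pd j u y * v y + u y * pd j v y) x := by
    show fderiv ℝ _ x _ = fderiv ℝ _ x _
    rw [hev.fderiv_eq]
  have a := (du (contDiffAt_pd j hu)).mul (du hv)
  have b := (du hu).mul (du (contDiffAt_pd j hv))
  have e2 : pd j (fun y => pd j u y * v y + u y * pd j v y) x =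
      pd j (fun y => pd j u y * v y) x + pd j (fun y => u y * pd j v y) x := by
    have := (a.hasFDerivAt.add b.hasFDerivAt).fderiv
    show fderiv ℝ _ x _ = fderiv ℝ _ x _ + fderiv ℝ _ x _
    rw [← add_apply]
    exact congrArg (fun L => L (EuclideanSpace.single j 1)) this
  rw [e1, e2, pd_mul (du (contDiffAt_pd j hu)) (du hv), pd_mul (du hu) (du (contDiffAt_pd j hv))]
  ring

/-- The commutator of the magnetic Schrödinger operator with multiplication by `Z`. -/
lemma magSchrodinger_mul_sub (W : Euc d → Euc d) (q : Euc d → ℂ) {Z u : Euc d → ℂ} {x : Euc d}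
    (hZ : ContDiffAt ℝ (⊤ : ℕ∞) Z x) (hu : ContDiffAt ℝ (⊤ : ℕ∞) u x) :
    magSchrodinger W q (fun y => Z y * u y) x - Z x * magSchrodinger W q u x =
      ∑ j, (-(pd j (pd j Z) x * u x) - 2 * (pd j Z x * pd j u x)
        - 2 * I * (W x j * pd j Z x * u x)) := by
  have dZ := hZ.differentiableAt (by simp)
  have du := hu.differentiableAt (by simp)
  simp only [magSchrodinger, pd_pd_mul _ hZ hu, pd_mul dZ du, mul_add, Finset.sum_add_distrib,
    Finset.sum_sub_distrib, ← Finset.mul_sum, Finset.sum_neg_distrib]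
  have e : ∑ j, ((W x j : ℝ) : ℂ) * (Z x * pd j u x) = Z x * ∑ j, ((W x j : ℝ) : ℂ) * pd j u x := by
    rw [Finset.mul_sum]
    exact Finset.sum_congr rfl fun j _ => by ring
  rw [e]
  simp only [← mul_assoc, ← Finset.sum_mul]
  ring

lemma contDiffAt_carlWeight {x : Euc d} (hx : x ≠ 0) {m : WithTop ℕ∞} :
    ContDiffAt ℝ m (carlWeight (d := d)) x :=
  (contDiffAt_norm ℝ hx).log (norm_ne_zero_iff.2 hx)

lemma continuousOn_pd_carlWeight (j : Fin d) :
    ContinuousOn (pd j (carlWeight (d := d))) {x | x ≠ 0} := by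
  have h : ContDiffOn ℝ 1 (carlWeight (d := d)) {x | x ≠ 0} :=
    fun x hx => (contDiffAt_carlWeight hx).contDiffWithinAt
  exact (h.continuousOn_fderiv_of_isOpen isOpen_ne (by simp)).clm_apply continuousOn_const

/-- The exponential weight `e^{-φ/h - φ²/(2ε)}`. -/
def expWeight {d : ℕ} (h ε : ℝ) (x : Euc d) : ℂ :=
  Complex.exp (((-(carlWeight x / h + (carlWeight x) ^ 2 / (2 * ε)) : ℝ) : ℂ))

lemma contDiffAt_expWeight (h ε : ℝ) {x : Euc d} (hx : x ≠ 0) :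
    ContDiffAt ℝ (⊤ : ℕ∞) (expWeight h ε) x := by
  have hφ := contDiffAt_carlWeight hx (m := (⊤ : ℕ∞))
  have : ContDiffAt ℝ (⊤ : ℕ∞)
      (fun y : Euc d => -(carlWeight y / h + (carlWeight y) ^ 2 / (2 * ε))) x :=
    ((hφ.div_const h).add ((hφ.pow 2).div_const _)).neg
  exact (Complex.ofRealCLM.contDiff.contDiffAt.comp x this).cexp

lemma pd_expWeight {h ε : ℝ} (j : Fin d) {x : Euc d} (hx : x ≠ 0) :
    pd j (expWeight h ε) x =
      -(((1 / h + carlWeight x / ε) * pd j carlWeight x : ℝ) : ℂ) * expWeight h ε x := by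
  have hφ := ((contDiffAt_carlWeight hx (m := 1)).differentiableAt (by simp)).hasFDerivAt
  have h1 : HasDerivAt (fun t : ℝ => Complex.exp (((-(t / h + t ^ 2 / (2 * ε)) : ℝ) : ℂ)))
      (Complex.exp (((-(carlWeight x / h + carlWeight x ^ 2 / (2 * ε)) : ℝ) : ℂ)) *
        ((-(1 / h + (2 * carlWeight x) / (2 * ε)) : ℝ) : ℂ)) (carlWeight x) := by
    have a : HasDerivAt (fun t : ℝ => -(t / h + t ^ 2 / (2 * ε)))
        (-(1 / h + (2 * carlWeight x) / (2 * ε))) (carlWeight x) := by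
      have := (((hasDerivAt_id (carlWeight x)).div_const h).add
        (((hasDerivAt_id (carlWeight x)).pow 2).div_const (2 * ε))).neg
      simp only [id, Nat.cast_ofNat, Nat.add_one_sub_one, pow_one, mul_one] at this
      exact this
    exact a.ofReal_comp.cexp
  have h2 := (h1.hasFDerivAt.comp x hφ).fderiv
  have h3 : pd j (expWeight h ε) x = _ :=
    congrArg (fun L => L (EuclideanSpace.single j 1)) h2
  rw [h3]
  have e : (2 * carlWeight x) / (2 * ε) = carlWeight x / ε := mul_div_mul_left _ _ two_ne_zero
  simp only [e, expWeight, pd]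
  simp
  ring

/-- The commutator of the conjugated operator with multiplication by `Z`, away from the origin. -/
lemma conjOpEps_mul_sub (h ε : ℝ) (hh : h ≠ 0) (W : Euc d → Euc d) (q : Euc d → ℂ)
    {Z w : Euc d → ℂ} {x : Euc d} (hx : x ≠ 0)
    (hZ : ContDiffAt ℝ (⊤ : ℕ∞) Z x) (hw : ContDiffAt ℝ (⊤ : ℕ∞) w x) :
    conjOpEps h ε W q (fun y => Z y * w y) x - Z x * conjOpEps h ε W q w x =
      h * ∑ j, (-(h * pd j (pd j Z) x * w x) - 2 * h * (pd j Z x * pd j w x)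
        + 2 * (pd j Z x * (((1 + h * carlWeight x / ε) * pd j carlWeight x : ℝ) : ℂ) * w x)
        - 2 * I * (h * W x j * pd j Z x * w x)) := by
  have hE := contDiffAt_expWeight h ε hx
  have hmul : (fun y => expWeight h ε y * (Z y * w y)) =
      fun y => Z y * (expWeight h ε y * w y) := by
    ext y; ring
  have key := magSchrodinger_mul_sub W q hZ (hE.mul hw)
  have hEE : Complex.exp (((carlWeight x / h + (carlWeight x) ^ 2 / (2 * ε) : ℝ) : ℂ)) *
      expWeight h ε x = 1 := by
    rw [expWeight, ← Complex.exp_add]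
    simp
  set E' := Complex.exp (((carlWeight x / h + (carlWeight x) ^ 2 / (2 * ε) : ℝ) : ℂ)) with hE'
  have lhs : conjOpEps h ε W q (fun y => Z y * w y) x - Z x * conjOpEps h ε W q w x =
      h ^ 2 * E' * (magSchrodinger W q (fun y => Z y * (expWeight h ε y * w y)) x -
        Z x * magSchrodinger W q (fun y => expWeight h ε y * w y) x) := by
    rw [← hmul]
    simp only [conjOpEps, expWeight, hE']
    ring
  rw [lhs, key, Finset.mul_sum, Finset.mul_sum]
  refine Finset.sum_congr rfl fun j _ => ?_
  rw [pd_mul (hE.differentiableAt (by simp)) (hw.differentiableAt (by simp)), pd_expWeight j hx]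
  have hhc : (h : ℂ) ≠ 0 := by exact_mod_cast hh
  have e : (((1 + h * carlWeight x / ε) * pd j carlWeight x : ℝ) : ℂ) =
      h * (((1 / h + carlWeight x / ε) * pd j carlWeight x : ℝ) : ℂ) := by
    push_cast
    field_simp
  rw [e]
  linear_combination (h ^ 2 * (-(pd j (pd j Z) x * w x) - 2 * (pd j Z x * pd j w x)
        + 2 * (pd j Z x * (((1 / h + carlWeight x / ε) * pd j carlWeight x : ℝ) : ℂ) * w x)
        - 2 * I * (W x j * pd j Z x * w x)) : ℂ) * hEE

end Derivatives

section Integrals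

variable {d : ℕ}

lemma integral_mul_mul_pd (j : Fin d) {a ψ w : Euc d → ℂ}
    (ha : ContDiff ℝ (⊤ : ℕ∞) a) (hψ : ContDiff ℝ (⊤ : ℕ∞) ψ) (hw : ContDiff ℝ (⊤ : ℕ∞) w)
    (hwc : HasCompactSupport w) :
    Integrable (fun x => a x * ψ x * pd j w x + pd j (fun y => a y * ψ y) x * w x) ∧
      ∫ x, (a x * ψ x * pd j w x + pd j (fun y => a y * ψ y) x * w x) = 0 := by
  have haψ := ha.mul hψ
  have i1 : Integrable (fun x => a x * ψ x * pd j w x) :=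
    (haψ.continuous.mul (contDiff_pd j hw).continuous).integrable_of_hasCompactSupport
      (hasCompactSupport_pd j hwc).mul_left
  have i2 : Integrable (fun x => pd j (fun y => a y * ψ y) x * w x) :=
    ((contDiff_pd j haψ).continuous.mul hw.continuous).integrable_of_hasCompactSupport
      hwc.mul_left
  have i3 : Integrable (fun x => a x * ψ x * w x) :=
    (haψ.continuous.mul hw.continuous).integrable_of_hasCompactSupport hwc.mul_left
  refine ⟨i1.add i2, ?_⟩
  rw [integral_add i1 i2]
  have := integral_mul_fderiv_eq_neg_fderiv_mul_of_integrable (μ := volume)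
    (v := EuclideanSpace.single j (1 : ℝ)) (f := fun x => a x * ψ x) (g := w) i2 i1 i3
    (fun x _ => haψ.differentiable (by simp) x) (fun x _ => hw.differentiable (by simp) x)
  exact (congrArg (· + _) this).trans (neg_add_cancel _)

/-- Pairing against a test function in the unit ball of semiclassical `H¹`. -/
lemma integral_mul_le_L2normOn {U : Set (Euc d)} {w ψ : Euc d → ℂ} {h : ℝ}
    (hh : 0 ≤ h) (hw : IsTest U w) (hψ : IsTest U ψ) (hH : H1norm h U ψ ≤ 1) :
    Integrable (fun x => ‖w x‖ * (‖ψ x‖ + ∑ j, h * ‖pd j ψ x‖)) ∧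
    ∫ x in U, ‖w x‖ * (‖ψ x‖ + ∑ j, h * ‖pd j ψ x‖) ≤ Real.sqrt (d + 1) * L2normOn U w := by
  have cw := hw.1.continuous
  have cψ := hψ.1.continuous
  have cp : ∀ j, Continuous (pd j ψ) := fun j => (contDiff_pd j hψ.1).continuous
  have cf : Continuous (fun x => ‖ψ x‖ + ∑ j, h * ‖pd j ψ x‖) := by fun_prop
  have sf : HasCompactSupport (fun x => ‖ψ x‖ + ∑ j, h * ‖pd j ψ x‖) := by
    refine hψ.2.1.mono' ?_
    intro x hx
    by_contra hn
    apply hx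
    have h0 : ψ x = 0 := image_eq_zero_of_notMem_tsupport hn
    have h1 : ∀ j, pd j ψ x = 0 := fun j => by
      simp [pd, fderiv_of_notMem_tsupport (𝕜 := ℝ) hn]
    simp [h0, h1]
  have swn : HasCompactSupport (fun x => ‖w x‖) := hw.2.1.norm
  have mw : MemLp (fun x => ‖w x‖) 2 (volume.restrict U) :=
    (cw.norm.memLp_of_hasCompactSupport swn).restrict U
  have mf : MemLp (fun x => ‖ψ x‖ + ∑ j, h * ‖pd j ψ x‖) 2 (volume.restrict U) :=
    (cf.memLp_of_hasCompactSupport sf).restrict U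
  refine ⟨(cw.norm.mul cf).integrable_of_hasCompactSupport swn.mul_right, ?_⟩
  have iψ : Integrable (fun x => ‖ψ x‖ ^ 2) (volume.restrict U) :=
    ((cψ.memLp_of_hasCompactSupport hψ.2.1).restrict U).integrable_norm_pow two_ne_zero
  have ip : Integrable (fun x => ∑ j, ‖pd j ψ x‖ ^ 2) (volume.restrict U) :=
    integrable_finsetSum _ fun j _ =>
      (((cp j).memLp_of_hasCompactSupport
        (hasCompactSupport_pd j hψ.2.1)).restrict U).integrable_norm_pow two_ne_zero
  have hf2 : ∫ x in U, (‖ψ x‖ + ∑ j, h * ‖pd j ψ x‖) ^ 2 ≤ d + 1 := by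
    have hH' : (∫ x in U, ‖ψ x‖ ^ 2) + h ^ 2 * ∫ x in U, ∑ j, ‖pd j ψ x‖ ^ 2 ≤ 1 := by
      simpa using (Real.sqrt_le_iff.1 hH).2
    have hpt : ∀ x, (‖ψ x‖ + ∑ j, h * ‖pd j ψ x‖) ^ 2 ≤
        (d + 1) * (‖ψ x‖ ^ 2 + h ^ 2 * ∑ j, ‖pd j ψ x‖ ^ 2) := fun x => by
      have := sq_sum_le_card_mul_sum_sq (s := (Finset.univ : Finset (Option (Fin d))))
        (f := fun o => o.elim ‖ψ x‖ (fun j => h * ‖pd j ψ x‖))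
      simpa [Fintype.sum_option, mul_pow, Finset.mul_sum] using this
    calc ∫ x in U, (‖ψ x‖ + ∑ j, h * ‖pd j ψ x‖) ^ 2
        ≤ ∫ x in U, (d + 1) * (‖ψ x‖ ^ 2 + h ^ 2 * ∑ j, ‖pd j ψ x‖ ^ 2) :=
          integral_mono mf.integrable_sq ((iψ.add (ip.const_mul _)).const_mul _) hpt
      _ = (d + 1) * ((∫ x in U, ‖ψ x‖ ^ 2) + h ^ 2 * ∫ x in U, ∑ j, ‖pd j ψ x‖ ^ 2) := by
          rw [integral_const_mul, integral_add iψ (ip.const_mul _), integral_const_mul]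
      _ ≤ (d + 1) * 1 := by gcongr
      _ = d + 1 := mul_one _
  have hCS : ∫ x in U, ‖w x‖ * (‖ψ x‖ + ∑ j, h * ‖pd j ψ x‖) ≤
      Real.sqrt (∫ x in U, ‖w x‖ ^ 2) *
        Real.sqrt (∫ x in U, (‖ψ x‖ + ∑ j, h * ‖pd j ψ x‖) ^ 2) := by
    have := integral_mul_le_Lp_mul_Lq_of_nonneg Real.HolderConjugate.two_two
      (f := fun x => ‖w x‖) (g := fun x => ‖ψ x‖ + ∑ j, h * ‖pd j ψ x‖)
      (Filter.Eventually.of_forall fun x => norm_nonneg _)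
      (Filter.Eventually.of_forall fun x => by dsimp; positivity)
      (by simpa using mw) (by simpa using mf)
    simpa [Real.sqrt_eq_rpow] using this
  calc _ ≤ _ := hCS
    _ ≤ L2normOn U w * Real.sqrt (d + 1) := by
      unfold L2normOn
      gcongr
    _ = _ := mul_comm _ _

end Integrals

section Pairing

variable {d : ℕ}

/-- Bound for the coefficients of the commutator of `conjOpEps` with multiplication by `Z`. -/
def commCoeff (ε : ℝ) (W : Euc d → Euc d) (Z : Euc d → ℂ) (x : Euc d) : ℝ :=
  ∑ j, (‖pd j (pd j Z) x‖ + 2 * ‖pd j Z x‖ * ((1 + |carlWeight x| / ε) * |pd j carlWeight x|)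
    + 2 * |W x j| * ‖pd j Z x‖ + 2 * ‖pd j Z x‖)

lemma continuousOn_commCoeff (ε : ℝ) {W : Euc d → Euc d} (hW : Continuous W) {Z : Euc d → ℂ}
    (hZ : ContDiff ℝ (⊤ : ℕ∞) Z) : ContinuousOn (commCoeff ε W Z) {x | x ≠ 0} := by
  have c1 : ∀ j, ContinuousOn (pd j Z) {x | x ≠ 0} :=
    fun j => (contDiff_pd j hZ).continuous.continuousOn
  have c2 : ∀ j, ContinuousOn (pd j (pd j Z)) {x | x ≠ 0} :=
    fun j => (contDiff_pd j (contDiff_pd j hZ)).continuous.continuousOn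
  have c3 : ContinuousOn (carlWeight (d := d)) {x | x ≠ 0} :=
    fun x hx => (contDiffAt_carlWeight hx (m := 0)).continuousAt.continuousWithinAt
  have c4 : ∀ j, ContinuousOn (pd j (carlWeight (d := d))) {x | x ≠ 0} :=
    continuousOn_pd_carlWeight
  have c5 : ∀ j, ContinuousOn (fun x => W x j) {x | x ≠ 0} := fun j => by fun_prop
  refine continuousOn_finsetSum _ fun j _ => ?_
  exact (((c2 j).norm.add ((continuousOn_const.mul (c1 j).norm).mul
    ((continuousOn_const.add (c3.abs.div_const _)).mul (c4 j).abs))).add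
    ((continuousOn_const.mul (c5 j).abs).mul (c1 j).norm)).add
    (continuousOn_const.mul (c1 j).norm)

/-- After integration by parts, the commutator paired with `ψ` is pointwise `O(h)`. -/
lemma norm_comm_add_divergence_le {h ε : ℝ} (hh : h ∈ Ioc (0 : ℝ) 1) (hε : 0 < ε)
    (W : Euc d → Euc d) (q : Euc d → ℂ) {Z w ψ : Euc d → ℂ} {x : Euc d} (hx : x ≠ 0)
    (hZ : ContDiff ℝ (⊤ : ℕ∞) Z) (hw : ContDiff ℝ (⊤ : ℕ∞) w) (hψ : ContDiff ℝ (⊤ : ℕ∞) ψ) :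
    ‖(conjOpEps h ε W q (fun y => Z y * w y) x - Z x * conjOpEps h ε W q w x) * conj (ψ x) +
      2 * h ^ 2 * ∑ j, (pd j Z x * conj (ψ x) * pd j w x +
        pd j (fun y => pd j Z y * conj (ψ y)) x * w x)‖ ≤
      h * commCoeff ε W Z x * (‖w x‖ * (‖ψ x‖ + ∑ j, h * ‖pd j ψ x‖)) := by
  obtain ⟨h0, h1⟩ := hh
  have dψ : DifferentiableAt ℝ (fun y => conj (ψ y)) x :=
    (Complex.conjCLE.contDiff.comp hψ).differentiable (by simp) x
  have key : (conjOpEps h ε W q (fun y => Z y * w y) x - Z x * conjOpEps h ε W q w x) *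
        conj (ψ x) +
      2 * h ^ 2 * ∑ j, (pd j Z x * conj (ψ x) * pd j w x +
        pd j (fun y => pd j Z y * conj (ψ y)) x * w x) =
      h * w x * ∑ j, (h * pd j (pd j Z) x * conj (ψ x)
        + 2 * pd j Z x * (((1 + h * carlWeight x / ε) * pd j carlWeight x : ℝ) : ℂ) * conj (ψ x)
        - 2 * I * h * W x j * pd j Z x * conj (ψ x)
        + 2 * pd j Z x * (h * conj (pd j ψ x))) := by
    rw [conjOpEps_mul_sub h ε h0.ne' W q hx hZ.contDiffAt hw.contDiffAt, Finset.mul_sum,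
      Finset.mul_sum, Finset.mul_sum, Finset.sum_mul, ← Finset.sum_add_distrib]
    refine Finset.sum_congr rfl fun j _ => ?_
    rw [pd_mul ((contDiff_pd j hZ).differentiable (by simp) x) dψ, pd_conj]
    ring
  rw [key, norm_mul, norm_mul, Complex.norm_real, Real.norm_of_nonneg h0.le]
  set f := ‖ψ x‖ + ∑ j, h * ‖pd j ψ x‖ with hf
  have hψf : ‖ψ x‖ ≤ f := le_add_of_nonneg_right (by positivity)
  have hpf : ∀ j, h * ‖pd j ψ x‖ ≤ f := fun j =>
    (Finset.single_le_sum (f := fun j => h * ‖pd j ψ x‖) (fun j _ => by positivity)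
      (Finset.mem_univ j)).trans (le_add_of_nonneg_left (norm_nonneg _))
  have hterm : ∀ j, ‖h * pd j (pd j Z) x * conj (ψ x)
        + 2 * pd j Z x * (((1 + h * carlWeight x / ε) * pd j carlWeight x : ℝ) : ℂ) * conj (ψ x)
        - 2 * I * h * W x j * pd j Z x * conj (ψ x)
        + 2 * pd j Z x * (h * conj (pd j ψ x))‖ ≤
      (‖pd j (pd j Z) x‖ + 2 * ‖pd j Z x‖ * ((1 + |carlWeight x| / ε) * |pd j carlWeight x|)
        + 2 * |W x j| * ‖pd j Z x‖ + 2 * ‖pd j Z x‖) * f := fun j => by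
    have t1 : ‖h * pd j (pd j Z) x * conj (ψ x)‖ ≤ ‖pd j (pd j Z) x‖ * f := by
      simp only [norm_mul, Complex.norm_real, Real.norm_of_nonneg h0.le, RCLike.norm_conj]
      gcongr
      exact mul_le_of_le_one_left (norm_nonneg _) h1
    have t2 : ‖2 * pd j Z x * (((1 + h * carlWeight x / ε) * pd j carlWeight x : ℝ) : ℂ) *
        conj (ψ x)‖ ≤
        2 * ‖pd j Z x‖ * ((1 + |carlWeight x| / ε) * |pd j carlWeight x|) * f := by
      have : |1 + h * carlWeight x / ε| ≤ 1 + |carlWeight x| / ε := by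
        refine (abs_add_le _ _).trans ?_
        rw [abs_one, abs_div, abs_mul, abs_of_pos h0, abs_of_pos hε]
        gcongr
        exact mul_le_of_le_one_left (abs_nonneg _) h1
      simp only [norm_mul, Complex.norm_real, RCLike.norm_conj, Complex.norm_two, Real.norm_eq_abs]
      gcongr
    have t3 : ‖2 * I * h * W x j * pd j Z x * conj (ψ x)‖ ≤
        2 * |W x j| * ‖pd j Z x‖ * f := by
      simp only [norm_mul, Complex.norm_real, RCLike.norm_conj, Complex.norm_two, Complex.norm_I,
        Real.norm_of_nonneg h0.le, Real.norm_eq_abs]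
      gcongr
      linarith
    have t4 : ‖2 * pd j Z x * (h * conj (pd j ψ x))‖ ≤ 2 * ‖pd j Z x‖ * f := by
      simp only [norm_mul, Complex.norm_real, RCLike.norm_conj, Complex.norm_two,
        Real.norm_of_nonneg h0.le]
      gcongr
      exact hpf j
    refine (norm_add_le _ _).trans ((add_le_add ((norm_sub_le _ _).trans
      (add_le_add ((norm_add_le _ _).trans (add_le_add t1 t2)) t3)) t4).trans_eq ?_)
    ring
  calc h * ‖w x‖ * _ ≤ h * ‖w x‖ * (commCoeff ε W Z x * f) := by
        gcongr
        rw [commCoeff, Finset.sum_mul]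
        exact (norm_sum_le _ _).trans (Finset.sum_le_sum fun j _ => hterm j)
    _ = _ := by ring

end Pairing

/-- Commutator of the conjugated operator with a smooth cutoff is `O(h)` from
`L²` to semiclassical `H⁻¹`. -/
theorem stmt15 (n : ℕ) (hn : 2 ≤ n)
    (U : Set (Euc (n + 1))) (hUopen : IsOpen U) (hUbdd : Bornology.IsBounded U)
    (hU0 : (0 : Euc (n + 1)) ∉ closure U)
    (ζ : Euc (n + 1) → ℝ) (hζ : IsTestR {x : Euc (n + 1) | x ≠ 0} ζ)
    (W : Euc (n + 1) → Euc (n + 1)) (hW : ContDiff ℝ 2 W)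
    (q : Euc (n + 1) → ℂ) (hq_meas : Measurable q) (hq_bdd : ∃ M : ℝ, ∀ x, ‖q x‖ ≤ M)
    (ε : ℝ) (hε : 0 < ε) :
    ∃ C > (0 : ℝ), ∀ h ∈ Set.Ioc (0 : ℝ) 1, ∀ w : Euc (n + 1) → ℂ, IsTest U w →
      Hneg1norm h U
          (fun x =>
            conjOpEps h ε W q (fun y => ((ζ y : ℝ) : ℂ) * w y) x -
              ((ζ x : ℝ) : ℂ) * conjOpEps h ε W q w x) ≤
        C * h * L2normOn U w := by
  set Z : Euc (n + 1) → ℂ := fun y => ((ζ y : ℝ) : ℂ) with hZdef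
  have hZ : ContDiff ℝ (⊤ : ℕ∞) Z := Complex.ofRealCLM.contDiff.comp hζ.1
  have hne : ∀ x ∈ closure U, x ≠ 0 := fun x hx h0 => hU0 (h0 ▸ hx)
  obtain ⟨M, hM⟩ := hUbdd.isCompact_closure.exists_bound_of_continuousOn
    ((continuousOn_commCoeff ε hW.continuous hZ).mono hne)
  have hM' : ∀ x ∈ U, commCoeff ε W Z x ≤ |M| + 1 := fun x hx =>
    ((le_abs_self _).trans (hM x (subset_closure hx))).trans
      ((le_abs_self M).trans (le_add_of_nonneg_right zero_le_one))
  refine ⟨(|M| + 1) * Real.sqrt ((n + 1 : ℕ) + 1), by positivity, fun h hh w hw => ?_⟩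
  have h0 := hh.1
  have hL : 0 ≤ L2normOn U w := Real.sqrt_nonneg _
  refine Real.sSup_le ?_ (by positivity)
  rintro r ⟨ψ, hψ, hH, rfl⟩
  obtain ⟨hint, hle⟩ := integral_mul_le_L2normOn h0.le hw hψ hH
  set c : Euc (n + 1) → ℂ := fun x =>
    (conjOpEps h ε W q (fun y => Z y * w y) x - Z x * conjOpEps h ε W q w x) * conj (ψ x) with hc
  by_cases hci : Integrable c (volume.restrict U)
  swap
  · rw [integral_undef hci, norm_zero]
    positivity
  set D : Fin (n + 1) → Euc (n + 1) → ℂ := fun j x =>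
    pd j Z x * conj (ψ x) * pd j w x + pd j (fun y => pd j Z y * conj (ψ y)) x * w x with hD
  have hDj : ∀ j, Integrable (D j) ∧ ∫ x in U, D j x = 0 := fun j => by
    obtain ⟨hi, h0⟩ := integral_mul_mul_pd j (contDiff_pd j hZ)
      (Complex.conjCLE.contDiff.comp hψ.1) hw.1 hw.2.1
    refine ⟨hi, (setIntegral_eq_integral_of_forall_compl_eq_zero fun x hx => ?_).trans h0⟩
    have hxs : x ∉ tsupport w := fun hx' => hx (hw.2.2 hx')
    simp [hD, pd, fderiv_of_notMem_tsupport (𝕜 := ℝ) hxs, image_eq_zero_of_notMem_tsupport hxs]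
  have hsum : ∫ x in U, c x = ∫ x in U, (c x + 2 * h ^ 2 * ∑ j, D j x) := by
    have hi : Integrable (fun x => ∑ j, D j x) (volume.restrict U) :=
      integrable_finsetSum _ fun j _ => (hDj j).1.restrict
    rw [integral_add hci (hi.const_mul _), integral_const_mul,
      integral_finsetSum _ fun j _ => (hDj j).1.restrict]
    simp [hDj]
  calc ‖∫ x in U, c x‖ = ‖∫ x in U, (c x + 2 * h ^ 2 * ∑ j, D j x)‖ := by rw [hsum]
    _ ≤ ∫ x in U, h * (|M| + 1) * (‖w x‖ * (‖ψ x‖ + ∑ j, h * ‖pd j ψ x‖)) := by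
        refine norm_integral_le_of_norm_le (hint.restrict.const_mul _) ?_
        filter_upwards [ae_restrict_mem hUopen.measurableSet] with x hx
        refine (norm_comm_add_divergence_le hh hε W q (hne x (subset_closure hx)) hZ hw.1
          hψ.1).trans ?_
        gcongr
        exact hM' x hx
    _ ≤ h * (|M| + 1) * (Real.sqrt ((n + 1 : ℕ) + 1) * L2normOn U w) := by
        rw [integral_const_mul]
        gcongr
    _ = _ := by ring
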